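/- arXiv:2408.00697 — 2 statements merged into one kernel-verified Lean document; each statement's English description precedes it below -/
import Mathlib

section
/- The Lie bracket g5 := [f0, f3], evaluated at the equilibrium x_e = (−ω0, 0, 0, 0, 0, 0), equals the vector (0, 0, ω0·β·(I1−I2)/(I2·I3), 0, −β/(2·I2), 0). -/
/- State x = (ω1, ω2, ω3, q1, q2, q3) : indices 0..5.  q4 = √(1 − q1² − q2² − q3²). -/
noncomputable def q4 (x : Fin 6 → ℝ) : ℝ := Real.sqrt (1 - x 3 ^ 2 - x 4 ^ 2 - x 5 ^ 2)

/-- Drift vector field of the satellite system. -/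
noncomputable def f0 (I1 I2 I3 om : ℝ) (x : Fin 6 → ℝ) : Fin 6 → ℝ :=
  ![(I2 - I3) / I1 * (x 1 * x 2)
      + 6 * om ^ 2 * (I2 - I3) / I1 * ((x 3 * q4 x + x 4 * x 5) * (2 * x 3 ^ 2 + 2 * x 4 ^ 2 - 1)),
    (I3 - I1) / I2 * (x 0 * x 2)
      + 6 * om ^ 2 * (I3 - I1) / I2 * ((x 3 * x 5 - x 4 * q4 x) * (2 * x 3 ^ 2 + 2 * x 4 ^ 2 - 1)),
    (I1 - I2) / I3 * (x 0 * x 1)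
      + 12 * om ^ 2 * (I1 - I2) / I3 * ((x 3 * q4 x + x 4 * x 5) * (x 4 * q4 x - x 3 * x 5)),
    (1 / 2) * ((x 0 + om) * q4 x - x 1 * x 5 + x 2 * x 4),
    (1 / 2) * ((x 0 - om) * x 5 + x 1 * q4 x - x 2 * x 3),
    (1 / 2) * (-(x 0 - om) * x 4 + x 1 * x 3 + x 2 * q4 x)]

/-- Controlled vector field f1. -/
noncomputable def f1 (I2 I3 b : ℝ) (x : Fin 6 → ℝ) : Fin 6 → ℝ :=
  ![0, -2 * b * (x 3 * x 5 + x 4 * q4 x) / I2, 2 * b * (x 3 * x 4 - x 5 * q4 x) / I3, 0, 0, 0]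

/-- Controlled vector field f2. -/
noncomputable def f2 (I1 I3 b : ℝ) (x : Fin 6 → ℝ) : Fin 6 → ℝ :=
  ![2 * b * (x 3 * x 5 + x 4 * q4 x) / I1, 0, b * (2 * x 4 ^ 2 + 2 * x 5 ^ 2 - 1) / I3, 0, 0, 0]

/-- Controlled vector field f3. -/
noncomputable def f3 (I1 I2 b : ℝ) (x : Fin 6 → ℝ) : Fin 6 → ℝ :=
  ![2 * b * (x 5 * q4 x - x 3 * x 4) / I1, b * (1 - 2 * x 4 ^ 2 - 2 * x 5 ^ 2) / I2, 0, 0, 0, 0]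

/-- Lie bracket of vector fields: [f,g](x) = Dg(x)·f(x) − Df(x)·g(x). -/
noncomputable def lieB (f g : (Fin 6 → ℝ) → (Fin 6 → ℝ)) (x : Fin 6 → ℝ) : Fin 6 → ℝ :=
  fderiv ℝ g x (f x) - fderiv ℝ f x (g x)

/-- The equilibrium point x_e = (−ω0, 0, 0, 0, 0, 0). -/
noncomputable def xe (om : ℝ) : Fin 6 → ℝ := ![-om, 0, 0, 0, 0, 0]

theorem q4_differentiableAt_xe (om : ℝ) : DifferentiableAt ℝ q4 (xe om) := by
  unfold q4
  refine DifferentiableAt.sqrt (by fun_prop) ?_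
  simp [xe]

theorem f0_differentiableAt_xe (I1 I2 I3 om : ℝ) :
    DifferentiableAt ℝ (f0 I1 I2 I3 om) (xe om) := by
  have hq := q4_differentiableAt_xe om
  rw [differentiableAt_pi]
  intro i
  fin_cases i <;> simp [f0] <;> fun_prop

theorem f0_xe (I1 I2 I3 om : ℝ) : f0 I1 I2 I3 om (xe om) = 0 := by
  ext i
  fin_cases i <;> simp [f0, xe]

theorem f3_xe (I1 I2 b om : ℝ) : f3 I1 I2 b (xe om) = ![0, b / I2, 0, 0, 0, 0] := by
  ext i
  fin_cases i <;> simp [f3, xe]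

/-- Along the `ω2` direction through the equilibrium, the drift is linear. -/
theorem f0_xe_add_smul (I1 I2 I3 om c t : ℝ) :
    f0 I1 I2 I3 om (xe om + t • ![0, c, 0, 0, 0, 0])
      = t • ![0, 0, -((I1 - I2) / I3 * (om * c)), 0, c / 2, 0] := by
  ext i
  fin_cases i <;> simp [f0, xe, q4] <;> ring

theorem fderiv_f0_xe (I1 I2 I3 om c : ℝ) :
    fderiv ℝ (f0 I1 I2 I3 om) (xe om) ![0, c, 0, 0, 0, 0]
      = ![0, 0, -((I1 - I2) / I3 * (om * c)), 0, c / 2, 0] := by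
  rw [← (f0_differentiableAt_xe I1 I2 I3 om).lineDeriv_eq_fderiv, lineDeriv]
  simp only [f0_xe_add_smul]
  simpa using ((hasDerivAt_id (0 : ℝ)).smul_const
    ![0, 0, -((I1 - I2) / I3 * (om * c)), 0, c / 2, 0]).deriv

/-- g5 = [f0, f3] evaluated at x_e. -/
theorem bracket_g5_at_equilibrium (I1 I2 I3 om b : ℝ)
    (hI1 : 0 < I1) (hI2 : 0 < I2) (hI3 : 0 < I3) (hom : om ≠ 0) (hb : b ≠ 0) :
    lieB (f0 I1 I2 I3 om) (f3 I1 I2 b) (xe om)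
      = ![0, 0, om * b * (I1 - I2) / (I2 * I3), 0, -(b / (2 * I2)), 0] := by
  rw [lieB, f0_xe, f3_xe, fderiv_f0_xe, map_zero, zero_sub]
  ext i
  fin_cases i <;> simp <;> field_simp
end

section
/- The iterated Lie bracket g1 := [f0, [f3, [f0, [f0, f2]]]], evaluated at the equilibrium x_e = (−ω0, 0, 0, 0, 0, 0), equals ( 3·ω0²·β²·(I1−I2−I3)·(I2−I3)/(I1²·I2·I3), 0, 0, 0, 0, 0 ), i.e. the scalar 3ω0²β²(I1−I2−I3)(I2−I3)/(I1²I2I3) times the first standard basis vector of ℝ^6. -/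
theorem fderiv_apply_of_hasDerivAt_line {f : (Fin 6 → ℝ) → Fin 6 → ℝ} {x v w : Fin 6 → ℝ}
    (hf : DifferentiableAt ℝ f x) (h : HasDerivAt (fun t : ℝ => f (x + t • v)) w 0) :
    fderiv ℝ f x v = w := by
  have h1 : HasDerivAt (fun t : ℝ => f (x + t • v)) (fderiv ℝ f x v) 0 :=
    hf.hasFDerivAt.hasLineDerivAt v
  exact h1.unique h

theorem contDiffAt_q4 {x : Fin 6 → ℝ} (hx : 0 < 1 - x 3 ^ 2 - x 4 ^ 2 - x 5 ^ 2) :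
    ContDiffAt ℝ ⊤ q4 x := by
  unfold q4
  exact ContDiffAt.sqrt (by fun_prop) hx.ne'

theorem contDiffAt_f0 (I1 I2 I3 om : ℝ) {x : Fin 6 → ℝ}
    (hx : 0 < 1 - x 3 ^ 2 - x 4 ^ 2 - x 5 ^ 2) : ContDiffAt ℝ ⊤ (f0 I1 I2 I3 om) x := by
  have hq := contDiffAt_q4 hx
  rw [contDiffAt_pi]
  intro i
  fin_cases i <;> simp only [f0] <;> simp <;> fun_prop

theorem contDiffAt_f2 (I1 I3 b : ℝ) {x : Fin 6 → ℝ}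
    (hx : 0 < 1 - x 3 ^ 2 - x 4 ^ 2 - x 5 ^ 2) : ContDiffAt ℝ ⊤ (f2 I1 I3 b) x := by
  have hq := contDiffAt_q4 hx
  rw [contDiffAt_pi]
  intro i
  fin_cases i <;> simp only [f2] <;> simp <;> fun_prop

theorem contDiffAt_f3 (I1 I2 b : ℝ) {x : Fin 6 → ℝ}
    (hx : 0 < 1 - x 3 ^ 2 - x 4 ^ 2 - x 5 ^ 2) : ContDiffAt ℝ ⊤ (f3 I1 I2 b) x := by
  have hq := contDiffAt_q4 hx
  rw [contDiffAt_pi]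
  intro i
  fin_cases i <;> simp only [f3] <;> simp <;> fun_prop

theorem contDiffAt_lieB {f g : (Fin 6 → ℝ) → Fin 6 → ℝ} {x : Fin 6 → ℝ}
    (hf : ContDiffAt ℝ ⊤ f x) (hg : ContDiffAt ℝ ⊤ g x) : ContDiffAt ℝ ⊤ (lieB f g) x :=
  ContDiffAt.lieBracket_vectorField hf hg (by simp)

theorem hasDerivAt_line_apply (x v : Fin 6 → ℝ) (i : Fin 6) :
    HasDerivAt (fun t : ℝ => (x + t • v) i) (v i) 0 := by
  simpa using ((hasDerivAt_id (0 : ℝ)).mul_const (v i)).const_add (x i)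

theorem hasDerivAt_q4_line {x : Fin 6 → ℝ} (hx : 0 < 1 - x 3 ^ 2 - x 4 ^ 2 - x 5 ^ 2)
    (v : Fin 6 → ℝ) :
    HasDerivAt (fun t : ℝ => q4 (x + t • v))
      (-(x 3 * v 3 + x 4 * v 4 + x 5 * v 5) / q4 x) 0 := by
  have h := hasDerivAt_line_apply x v
  unfold q4
  refine ((((((h 3).pow 2).const_sub 1).sub ((h 4).pow 2)).sub ((h 5).pow 2)).sqrt
    (by simpa using hx.ne')).congr_deriv ?_
  simp
  have := (Real.sqrt_pos.mpr hx).ne'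
  field_simp
  ring

theorem fderiv_f2_apply (I1 I3 b : ℝ) {x : Fin 6 → ℝ}
    (hx : 0 < 1 - x 3 ^ 2 - x 4 ^ 2 - x 5 ^ 2) (v : Fin 6 → ℝ) :
    fderiv ℝ (f2 I1 I3 b) x v =
      ![2 * b * (v 3 * x 5 + x 3 * v 5 + v 4 * q4 x
          + x 4 * (-(x 3 * v 3 + x 4 * v 4 + x 5 * v 5) / q4 x)) / I1, 0,
        b * (4 * x 4 * v 4 + 4 * x 5 * v 5) / I3, 0, 0, 0] := by
  apply fderiv_apply_of_hasDerivAt_line ((contDiffAt_f2 I1 I3 b hx).differentiableAt (by simp))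
  have h := hasDerivAt_line_apply x v
  have hs := hasDerivAt_q4_line hx v
  rw [hasDerivAt_pi]
  intro i
  fin_cases i
  · refine (((((h 3).mul (h 5)).add ((h 4).mul hs)).const_mul (2 * b)).div_const I1).congr_deriv ?_
    simp [-mul_eq_mul_left_iff]
    ring
  · exact hasDerivAt_const _ _
  · refine (((((((h 4).pow 2).const_mul 2).add (((h 5).pow 2).const_mul 2)).sub_const
      1).const_mul b).div_const I3).congr_deriv ?_
    simp [-mul_eq_mul_left_iff]
    ring
  all_goals exact hasDerivAt_const _ _

theorem fderiv_f3_apply (I1 I2 b : ℝ) {x : Fin 6 → ℝ}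
    (hx : 0 < 1 - x 3 ^ 2 - x 4 ^ 2 - x 5 ^ 2) (v : Fin 6 → ℝ) :
    fderiv ℝ (f3 I1 I2 b) x v =
      ![2 * b * (v 5 * q4 x + x 5 * (-(x 3 * v 3 + x 4 * v 4 + x 5 * v 5) / q4 x)
          - (v 3 * x 4 + x 3 * v 4)) / I1,
        b * (-(4 * x 4 * v 4) - 4 * x 5 * v 5) / I2, 0, 0, 0, 0] := by
  apply fderiv_apply_of_hasDerivAt_line ((contDiffAt_f3 I1 I2 b hx).differentiableAt (by simp))
  have h := hasDerivAt_line_apply x v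
  have hs := hasDerivAt_q4_line hx v
  rw [hasDerivAt_pi]
  intro i
  fin_cases i
  · refine (((((h 5).mul hs).sub ((h 3).mul (h 4))).const_mul (2 * b)).div_const I1).congr_deriv ?_
    simp [-mul_eq_mul_left_iff]
  · refine ((((((((h 4).pow 2).const_mul 2).const_sub 1)).sub (((h 5).pow 2).const_mul
      2)).const_mul b).div_const I2).congr_deriv ?_
    simp [-mul_eq_mul_left_iff]
    ring
  all_goals exact hasDerivAt_const _ _

theorem fderiv_f0_apply (I1 I2 I3 om : ℝ) {x : Fin 6 → ℝ}
    (hx : 0 < 1 - x 3 ^ 2 - x 4 ^ 2 - x 5 ^ 2) (v : Fin 6 → ℝ) {s' : ℝ}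
    (hs' : s' = -(x 3 * v 3 + x 4 * v 4 + x 5 * v 5) / q4 x) :
    fderiv ℝ (f0 I1 I2 I3 om) x v =
      ![(I2 - I3) / I1 * (v 1 * x 2 + x 1 * v 2)
          + 6 * om ^ 2 * (I2 - I3) / I1 *
            ((v 3 * q4 x + x 3 * s' + (v 4 * x 5 + x 4 * v 5)) * (2 * x 3 ^ 2 + 2 * x 4 ^ 2 - 1)
              + (x 3 * q4 x + x 4 * x 5) * (4 * x 3 * v 3 + 4 * x 4 * v 4)),
        (I3 - I1) / I2 * (v 0 * x 2 + x 0 * v 2)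
          + 6 * om ^ 2 * (I3 - I1) / I2 *
            ((v 3 * x 5 + x 3 * v 5 - (v 4 * q4 x + x 4 * s')) * (2 * x 3 ^ 2 + 2 * x 4 ^ 2 - 1)
              + (x 3 * x 5 - x 4 * q4 x) * (4 * x 3 * v 3 + 4 * x 4 * v 4)),
        (I1 - I2) / I3 * (v 0 * x 1 + x 0 * v 1)
          + 12 * om ^ 2 * (I1 - I2) / I3 *
            ((v 3 * q4 x + x 3 * s' + (v 4 * x 5 + x 4 * v 5)) * (x 4 * q4 x - x 3 * x 5)
              + (x 3 * q4 x + x 4 * x 5) * (v 4 * q4 x + x 4 * s' - (v 3 * x 5 + x 3 * v 5))),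
        (1 / 2) * (v 0 * q4 x + (x 0 + om) * s' - (v 1 * x 5 + x 1 * v 5)
          + (v 2 * x 4 + x 2 * v 4)),
        (1 / 2) * (v 0 * x 5 + (x 0 - om) * v 5 + (v 1 * q4 x + x 1 * s')
          - (v 2 * x 3 + x 2 * v 3)),
        (1 / 2) * (-v 0 * x 4 - (x 0 - om) * v 4 + (v 1 * x 3 + x 1 * v 3)
          + (v 2 * q4 x + x 2 * s'))] := by
  apply fderiv_apply_of_hasDerivAt_line
    ((contDiffAt_f0 I1 I2 I3 om hx).differentiableAt (by simp))
  have h := hasDerivAt_line_apply x v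
  have hs := hasDerivAt_q4_line hx v
  rw [← hs'] at hs
  have hp := ((((h 3).pow 2).const_mul 2).add (((h 4).pow 2).const_mul 2)).sub_const 1
  have hr := ((h 3).mul hs).add ((h 4).mul (h 5))
  rw [hasDerivAt_pi]
  intro i
  fin_cases i
  · refine ((((h 1).mul (h 2)).const_mul ((I2 - I3) / I1)).add
      ((hr.mul hp).const_mul (6 * om ^ 2 * (I2 - I3) / I1))).congr_deriv ?_
    simp [-mul_eq_mul_left_iff]
    ring
  · refine ((((h 0).mul (h 2)).const_mul ((I3 - I1) / I2)).add
      (((((h 3).mul (h 5)).sub ((h 4).mul hs)).mul hp).const_mul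
        (6 * om ^ 2 * (I3 - I1) / I2))).congr_deriv ?_
    simp [-mul_eq_mul_left_iff]
    ring
  · refine ((((h 0).mul (h 1)).const_mul ((I1 - I2) / I3)).add
      ((hr.mul (((h 4).mul hs).sub ((h 3).mul (h 5)))).const_mul
        (12 * om ^ 2 * (I1 - I2) / I3))).congr_deriv ?_
    simp [-mul_eq_mul_left_iff]
  · refine ((((((h 0).add_const om).mul hs).sub ((h 1).mul (h 5))).add
      ((h 2).mul (h 4))).const_mul (1 / 2 : ℝ)).congr_deriv ?_
    simp [-mul_eq_mul_left_iff]
  · refine ((((((h 0).sub_const om).mul (h 5)).add ((h 1).mul hs)).sub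
      ((h 2).mul (h 3))).const_mul (1 / 2 : ℝ)).congr_deriv ?_
    simp [-mul_eq_mul_left_iff]
  · refine (((((((h 0).sub_const om).neg).mul (h 4)).add ((h 1).mul (h 3))).add
      ((h 2).mul hs)).const_mul (1 / 2 : ℝ)).congr_deriv ?_
    simp [-mul_eq_mul_left_iff]
    ring

/-- `[f0, f2]` on the subspace `ω1 = -ω0`, `q1 = q3 = 0`. -/
theorem lieB_f0_f2_apply (I1 I2 I3 om b w2 w3 p : ℝ) (hp : p ^ 2 < 1) :
    lieB (f0 I1 I2 I3 om) (f2 I1 I3 b) ![-om, w2, w3, 0, p, 0] =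
      ![b / I1 * w2 * (1 - 2 * p ^ 2) - (I2 - I3) / I1 * w2 * (b * (2 * p ^ 2 - 1) / I3),
        -((I3 - I1) / I2 * (w3 * (2 * b * p * √(1 - p ^ 2) / I1)
          - om * (b * (2 * p ^ 2 - 1) / I3))),
        2 * b * p * w2 * √(1 - p ^ 2) / I3
          - (I1 - I2) / I3 * (2 * b * p * √(1 - p ^ 2) / I1) * w2,
        -(1 / 2) * (2 * b * p * (1 - p ^ 2) / I1 + b * (2 * p ^ 2 - 1) / I3 * p),
        0,
        (1 / 2) * (2 * b * p ^ 2 * √(1 - p ^ 2) / I1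
          - b * (2 * p ^ 2 - 1) / I3 * √(1 - p ^ 2))] := by
  have hx : 0 < 1 - (![-om, w2, w3, 0, p, 0] : Fin 6 → ℝ) 3 ^ 2
      - (![-om, w2, w3, 0, p, 0] : Fin 6 → ℝ) 4 ^ 2
      - (![-om, w2, w3, 0, p, 0] : Fin 6 → ℝ) 5 ^ 2 := by
    simpa using hp
  have hq : q4 ![-om, w2, w3, 0, p, 0] = √(1 - p ^ 2) := by simp [q4]
  have hs := Real.sq_sqrt (sub_pos.mpr hp).le
  have hs0 := (Real.sqrt_pos.mpr (sub_pos.mpr hp)).ne'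
  unfold lieB
  rw [fderiv_f2_apply I1 I3 b hx, fderiv_f0_apply I1 I2 I3 om hx _ rfl]
  simp only [hq, f0, f2]
  generalize √(1 - p ^ 2) = s at hs hs0
  have hp2 : p ^ 2 = 1 - s ^ 2 := by linarith
  ext i
  fin_cases i <;> simp [-mul_eq_mul_left_iff]
  · field_simp
    rw [hp2]
    ring
  · ring
  · ring
  · rw [← hs]
    ring
  · ring

/-- `[f0, [f0, f2]]` on the line `ω = (-ω0, t, 0)`, `q = 0`. -/
theorem lieB_f0_lieB_f0_f2_apply (I1 I2 I3 om b t : ℝ) :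
    lieB (f0 I1 I2 I3 om) (lieB (f0 I1 I2 I3 om) (f2 I1 I3 b)) ![-om, t, 0, 0, 0, 0] =
      ![0, 0,
        b * t ^ 2 * (1 / I3 - (I1 - I2) / I3 / I1)
          - (I1 - I2) / I3 * (t * (b * t / I1 + (I2 - I3) / I1 * t * (b / I3))
            + om * ((I3 - I1) / I2 * om * (b / I3))),
        t * (-b / I1 - (I2 - I3) / I1 * b / (2 * I3) + b / (2 * I3)),
        (1 / 2) * ((I3 - I1) / I2 * om * (b / I3) + om * (b / I3)), 0] := by
  have hx : 0 < 1 - (![-om, t, 0, 0, 0, 0] : Fin 6 → ℝ) 3 ^ 2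
      - (![-om, t, 0, 0, 0, 0] : Fin 6 → ℝ) 4 ^ 2
      - (![-om, t, 0, 0, 0, 0] : Fin 6 → ℝ) 5 ^ 2 := by
    simp
  have hq : q4 ![-om, t, 0, 0, 0, 0] = 1 := by simp [q4]
  have hf0 : f0 I1 I2 I3 om ![-om, t, 0, 0, 0, 0] =
      ![0, 0, (I1 - I2) / I3 * (-om * t), 0, t / 2, 0] := by
    ext i
    fin_cases i <;> simp [f0, hq]
    ring
  have hV := lieB_f0_f2_apply I1 I2 I3 om b t 0 0 (by simp)
  have hD : fderiv ℝ (lieB (f0 I1 I2 I3 om) (f2 I1 I3 b)) ![-om, t, 0, 0, 0, 0]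
      ![0, 0, (I1 - I2) / I3 * (-om * t), 0, t / 2, 0] =
      ![0, 0, b * t ^ 2 * (1 / I3 - (I1 - I2) / I3 / I1),
        -(1 / 2) * (b * t / I1 - b / I3 * (t / 2)), 0, 0] := by
    apply fderiv_apply_of_hasDerivAt_line
      ((contDiffAt_lieB (contDiffAt_f0 I1 I2 I3 om hx)
        (contDiffAt_f2 I1 I3 b hx)).differentiableAt (by simp))
    have hp : HasDerivAt (fun e : ℝ => e * (t / 2)) (t / 2) 0 := hasDerivAt_mul_const _
    have hw : HasDerivAt (fun e : ℝ => e * ((I1 - I2) / I3 * (-om * t)))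
      ((I1 - I2) / I3 * (-om * t)) 0 := hasDerivAt_mul_const _
    have hp2 : HasDerivAt (fun e : ℝ => (e * (t / 2)) ^ 2) 0 0 :=
      (hp.pow 2).congr_deriv (by simp)
    have hs : HasDerivAt (fun e : ℝ => √(1 - (e * (t / 2)) ^ 2)) 0 0 :=
      ((hp2.const_sub 1).sqrt (by simp)).congr_deriv (by simp)
    have hu0 : HasDerivAt (fun e : ℝ => 2 * b * (e * (t / 2)) * √(1 - (e * (t / 2)) ^ 2) / I1)
        (b * t / I1) 0 :=
      (((hp.const_mul (2 * b)).mul hs).div_const I1).congr_deriv (by simp; ring)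
    have hu2 : HasDerivAt (fun e : ℝ => b * (2 * (e * (t / 2)) ^ 2 - 1) / I3) 0 0 :=
      ((((hp2.const_mul 2).sub_const 1).const_mul b).div_const I3).congr_deriv (by simp)
    have hev : ∀ᶠ e : ℝ in nhds 0, (e * (t / 2)) ^ 2 < 1 :=
      hp2.continuousAt.eventually_lt continuousAt_const (by simp)
    have hl : ∀ e : ℝ, (![-om, t, 0, 0, 0, 0] : Fin 6 → ℝ)
        + e • ![0, 0, (I1 - I2) / I3 * (-om * t), 0, t / 2, 0] =
        ![-om, t, e * ((I1 - I2) / I3 * (-om * t)), 0, e * (t / 2), 0] := by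
      intro e
      ext i
      fin_cases i <;> simp
    simp only [hl]
    refine HasDerivAt.congr_of_eventuallyEq ?_
      (hev.mono fun e he => lieB_f0_f2_apply I1 I2 I3 om b t _ _ he)
    rw [hasDerivAt_pi]
    intro i
    fin_cases i
    · refine ((((hp2.const_mul 2).const_sub 1).const_mul (b / I1 * t)).sub
        (hu2.const_mul ((I2 - I3) / I1 * t))).congr_deriv ?_
      simp
    · refine (((hw.mul hu0).sub (hu2.const_mul om)).const_mul
        ((I3 - I1) / I2)).neg.congr_deriv ?_
      simp
    · refine (((((hp.const_mul (2 * b)).mul_const t).mul hs).div_const I3).sub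
        ((hu0.const_mul ((I1 - I2) / I3)).mul_const t)).congr_deriv ?_
      simp
      ring
    · refine (((((hp.const_mul (2 * b)).mul (hp2.const_sub 1)).div_const I1).add
        (hu2.mul hp)).const_mul (-(1 / 2))).congr_deriv ?_
      simp
      ring
    · exact hasDerivAt_const _ _
    · refine (((((hp2.const_mul (2 * b)).mul hs).div_const I1).sub
        (hu2.mul hs)).const_mul (1 / 2)).congr_deriv ?_
      simp
  rw [lieB, hf0, hD, fderiv_f0_apply I1 I2 I3 om hx _ rfl, hV, hq]
  ext i
  fin_cases i <;> simp [-mul_eq_mul_left_iff]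
  all_goals ring

/-- g1 = [f0, [f3, [f0, [f0, f2]]]] evaluated at x_e. -/
theorem bracket_g1_at_equilibrium (I1 I2 I3 om b : ℝ)
    (hI1 : 0 < I1) (hI2 : 0 < I2) (hI3 : 0 < I3) (hom : om ≠ 0) (hb : b ≠ 0) :
    lieB (f0 I1 I2 I3 om)
        (lieB (f3 I1 I2 b) (lieB (f0 I1 I2 I3 om) (lieB (f0 I1 I2 I3 om) (f2 I1 I3 b)))) (xe om)
      = ![3 * om ^ 2 * b ^ 2 * (I1 - I2 - I3) * (I2 - I3) / (I1 ^ 2 * I2 * I3), 0, 0, 0, 0, 0] := by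
  have hx : 0 < 1 - xe om 3 ^ 2 - xe om 4 ^ 2 - xe om 5 ^ 2 := by simp [xe]
  have hq : q4 (xe om) = 1 := by simp [q4, xe]
  have hf0 : f0 I1 I2 I3 om (xe om) = 0 := by
    ext i
    fin_cases i <;> simp [f0, hq] <;> simp [xe]
  have hf3 : f3 I1 I2 b (xe om) = ![0, b / I2, 0, 0, 0, 0] := by
    ext i
    fin_cases i <;> simp [f3, hq] <;> simp [xe]
  have hW := lieB_f0_lieB_f0_f2_apply I1 I2 I3 om b
  have hD : fderiv ℝ (lieB (f0 I1 I2 I3 om) (lieB (f0 I1 I2 I3 om) (f2 I1 I3 b))) (xe om)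
      ![0, b / I2, 0, 0, 0, 0] =
      ![0, 0, 0, b / I2 * (-b / I1 - (I2 - I3) / I1 * b / (2 * I3) + b / (2 * I3)), 0, 0] := by
    have hf := contDiffAt_f0 I1 I2 I3 om hx
    apply fderiv_apply_of_hasDerivAt_line
      ((contDiffAt_lieB hf (contDiffAt_lieB hf (contDiffAt_f2 I1 I3 b hx))).differentiableAt
        (by simp))
    have hl : ∀ e : ℝ, xe om + e • ![0, b / I2, 0, 0, 0, 0] =
        ![-om, e * (b / I2), 0, 0, 0, 0] := by
      intro e
      ext i
      fin_cases i <;> simp [xe]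
    simp only [hl, hW]
    have ht : HasDerivAt (fun e : ℝ => e * (b / I2)) (b / I2) 0 := hasDerivAt_mul_const _
    rw [hasDerivAt_pi]
    intro i
    fin_cases i
    · exact hasDerivAt_const _ _
    · exact hasDerivAt_const _ _
    · refine ((((ht.pow 2).const_mul b).mul_const (1 / I3 - (I1 - I2) / I3 / I1)).sub
        (((ht.mul (((ht.const_mul b).div_const I1).add
          ((ht.const_mul ((I2 - I3) / I1)).mul_const (b / I3)))).add_const
            (om * ((I3 - I1) / I2 * om * (b / I3)))).const_mul ((I1 - I2) / I3))).congr_deriv ?_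
      simp
    · exact ht.mul_const _
    · exact hasDerivAt_const _ _
    · exact hasDerivAt_const _ _
  have hV : lieB (f3 I1 I2 b)
      (lieB (f0 I1 I2 I3 om) (lieB (f0 I1 I2 I3 om) (f2 I1 I3 b))) (xe om) =
      ![0, 0, 0, b / I2 * (-b / I1 - (I2 - I3) / I1 * b / (2 * I3) + b / (2 * I3)), 0, 0] := by
    rw [lieB, hf3, hD, fderiv_f3_apply I1 I2 b hx, hq, xe, hW 0]
    ext i
    fin_cases i <;> simp
  rw [lieB, hf0, map_zero, zero_sub, hV, fderiv_f0_apply I1 I2 I3 om hx _ rfl, hq]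
  ext i
  fin_cases i <;> simp [xe]
  field_simp
  ring
end
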